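/- Let α be a partition of an even number. If α is quasi-special, then its C-collapse α_C is special (in the e-count sense). -/

import Mathlib

namespace WFPaper

/-- The list of parts of a partition (multiset of positive integers) in weakly
decreasing order. -/
def sortedDesc (s : Multiset ℕ) : List ℕ := (s.sort (· ≤ ·)).reverse

/-- The `j`-th largest part of `s` (1-indexed); `0` if `j = 0` or `j > #s`. -/
def part (s : Multiset ℕ) (j : ℕ) : ℕ := (sortedDesc s).getD (j - 1) 0

/-- The smallest part of `s` (`0` if `s` is empty). -/
def minPart (s : Multiset ℕ) : ℕ := (s.sort (· ≤ ·)).getD 0 0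

/-- Sum of the `j` largest parts of `s`. -/
def psum (s : Multiset ℕ) (j : ℕ) : ℕ := ((sortedDesc s).take j).sum

/-- Dominance order: `DomLE a b` means `a ≤ b` in the dominance order, i.e.
for every `j` the sum of the `j` largest parts of `a` is at most that of `b`. -/
def DomLE (a b : Multiset ℕ) : Prop := ∀ j, psum a j ≤ psum b j

/-- All parts are positive. -/
def PosParts (s : Multiset ℕ) : Prop := ∀ x ∈ s, 0 < x

/-- A partition of an odd number in which every even part has even multiplicity
(a B-partition of `n` when the sum is `2*n+1`). -/
def IsTypeB (s : Multiset ℕ) : Prop :=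
  PosParts s ∧ Odd s.sum ∧ ∀ x, Even x → Even (s.count x)

/-- A partition of an even number in which every odd part has even multiplicity
(a C-partition of `n` when the sum is `2*n`). -/
def IsTypeC (s : Multiset ℕ) : Prop :=
  PosParts s ∧ Even s.sum ∧ ∀ x, Odd x → Even (s.count x)

/-- A partition of an even number in which every even part has even multiplicity
(a D-partition of `n` when the sum is `2*n`). -/
def IsTypeD (s : Multiset ℕ) : Prop :=
  PosParts s ∧ Even s.sum ∧ ∀ x, Even x → Even (s.count x)

/-- `IsCollapse T α β` : `β` is the dominance-largest partition of class `T` of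
the same number as `α` which is dominated by `α` (e.g. the B/C/D-collapse of `α`
for `T = IsTypeB/IsTypeC/IsTypeD`). -/
def IsCollapse (T : Multiset ℕ → Prop) (α β : Multiset ℕ) : Prop :=
  T β ∧ β.sum = α.sum ∧ DomLE β α ∧
    ∀ γ, T γ → γ.sum = α.sum → DomLE γ α → DomLE γ β

/-- The transpose (conjugate) partition: its `j`-th part (0-indexed `j`) is the
number of parts of `s` that are `≥ j+1`. -/
def transpose (s : Multiset ℕ) : Multiset ℕ :=
  (Multiset.range (part s 1)).map (fun j => (s.filter (fun x => j + 1 ≤ x)).card)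

/-- `λ⁻` : subtract 1 from the smallest part (the part being deleted if it
becomes 0). -/
def decMin (s : Multiset ℕ) : Multiset ℕ :=
  ((minPart s - 1) ::ₘ s.erase (minPart s)).filter (fun x => 0 < x)

/-- `λ⁺` : add 1 to the largest part. -/
def incMax (s : Multiset ℕ) : Multiset ℕ :=
  (part s 1 + 1) ::ₘ s.erase (part s 1)

/-- The subpartition `μ` of `T` whose multiplicity at an even `x` is 2 if
`m_T(x)` is even and nonzero, 1 if `m_T(x)` is odd, and 0 at odd `x`. -/
def muEven (T : Multiset ℕ) : Multiset ℕ :=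
  (T.toFinset.filter (fun x => Even x)).val.bind
    (fun x => Multiset.replicate (if Even (T.count x) then 2 else 1) x)

/-- The subpartition `μ` of `T` whose multiplicity at an odd `x` is 2 if
`m_T(x)` is even and nonzero, 1 if `m_T(x)` is odd, and 0 at even `x`. -/
def muOdd (T : Multiset ℕ) : Multiset ℕ :=
  (T.toFinset.filter (fun x => Odd x)).val.bind
    (fun x => Multiset.replicate (if Even (T.count x) then 2 else 1) x)

/-- The subpartition `π` of `T` consisting of the even parts of `T` of odd
multiplicity, each taken once. -/
def piEven (T : Multiset ℕ) : Multiset ℕ :=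
  (T.toFinset.filter (fun x => Even x ∧ Odd (T.count x))).val

/-- `k` is a (1-indexed) position of an odd part of `s`. -/
def OddIdx (s : Multiset ℕ) (k : ℕ) : Prop := 1 ≤ k ∧ Odd (part s k)

/-- `k` is a (1-indexed) position of an even part of `s`. -/
def EvenIdx (s : Multiset ℕ) (k : ℕ) : Prop :=
  1 ≤ k ∧ k ≤ Multiset.card s ∧ Even (part s k)

/-- `e_s(i,j)` : number of positions `i ≤ k ≤ j` with `s_k` even. -/
def eCount (s : Multiset ℕ) (i j : ℕ) : ℕ :=
  ((Finset.Icc i j).filter (fun k => Even (part s k))).card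

/-- number of positions `i ≤ k ≤ j` with `s_k` odd. -/
def oCount (s : Multiset ℕ) (i j : ℕ) : ℕ :=
  ((Finset.Icc i j).filter (fun k => Odd (part s k))).card

/-- `s` is special in the e-count sense: `e_s(1,t₁)` is even, and
`e_s(tᵢ,tᵢ₊₁)` is even for all `1 ≤ i ≤ p-1`, where `t₁ < ⋯ < t_p` are the
positions of the odd parts of `s`. -/
def IsSpecialE (s : Multiset ℕ) : Prop :=
  (∀ t, OddIdx s t → (∀ t', OddIdx s t' → t ≤ t') → Even (eCount s 1 t)) ∧
  (∀ i j, OddIdx s i → OddIdx s j → i < j →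
    (∀ k, OddIdx s k → k ≤ i ∨ j ≤ k) → Even (eCount s i j))

/-- `s` is quasi-special: `e_s(1,t₁)` is even, `e_s(tᵢ,tᵢ₊₁)` is even for all
`1 ≤ i ≤ p-2`, and the smallest part of `s` is odd with multiplicity 1. -/
def IsQuasiSpecialE (s : Multiset ℕ) : Prop :=
  (∀ t, OddIdx s t → (∀ t', OddIdx s t' → t ≤ t') → Even (eCount s 1 t)) ∧
  (∀ i j, OddIdx s i → OddIdx s j → i < j →
    (∀ k, OddIdx s k → k ≤ i ∨ j ≤ k) → (∃ k, OddIdx s k ∧ j < k) →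
      Even (eCount s i j)) ∧
  Odd (minPart s) ∧ s.count (minPart s) = 1

/-- Number of odd parts greater than every even part (equals the number of odd
parts greater than the largest even part, and the number of all odd parts if
there are no even parts). -/
def numOddDominant (s : Multiset ℕ) : ℕ :=
  (s.filter (fun x => Odd x ∧ ∀ y ∈ s, Even y → y < x)).card

/-- Between every pair of consecutive even parts of `s` (in the decreasing
listing of the parts) there is an even number of odd parts. -/
def EvenBetween (s : Multiset ℕ) : Prop :=
  ∀ i j, EvenIdx s i → EvenIdx s j → i < j →
    (∀ k, EvenIdx s k → k ≤ i ∨ j ≤ k) → Even (oCount s i j)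

/-- A special B-partition. -/
def IsSpecialTypeB (s : Multiset ℕ) : Prop :=
  IsTypeB s ∧ EvenBetween s ∧ Odd (numOddDominant s)

/-- A special D-partition. -/
def IsSpecialTypeD (s : Multiset ℕ) : Prop :=
  IsTypeD s ∧ EvenBetween s ∧ Even (numOddDominant s)

theorem sortedDesc_pairwise (s : Multiset ℕ) : (sortedDesc s).Pairwise (· ≥ ·) := by
  unfold sortedDesc
  rw [List.pairwise_reverse]
  exact Multiset.pairwise_sort s (· ≤ ·)

theorem coe_sortedDesc (s : Multiset ℕ) : (sortedDesc s : Multiset ℕ) = s := by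
  simp [sortedDesc]

theorem length_sortedDesc (s : Multiset ℕ) : (sortedDesc s).length = s.card := by
  simp [sortedDesc]

theorem part_eq_zero {s : Multiset ℕ} {j : ℕ} (h : s.card < j) : part s j = 0 := by
  unfold part
  rw [List.getD_eq_default]
  rw [length_sortedDesc]
  omega

theorem part_eq_getElem {s : Multiset ℕ} {j : ℕ} (h : j < (sortedDesc s).length) :
    part s (j + 1) = (sortedDesc s)[j] := by
  unfold part
  rw [Nat.add_sub_cancel, List.getD_eq_getElem _ _ h]

theorem part_antitone (s : Multiset ℕ) {i j : ℕ} (h : i ≤ j) : part s j ≤ part s i := by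
  by_cases hj : j - 1 < (sortedDesc s).length
  · have hi : i - 1 < (sortedDesc s).length := by omega
    unfold part
    rw [List.getD_eq_getElem _ _ hj, List.getD_eq_getElem _ _ hi]
    rcases (show i - 1 ≤ j - 1 by omega).eq_or_lt with h' | h'
    · simp [h']
    · exact List.pairwise_iff_getElem.mp (sortedDesc_pairwise s) _ _ hi hj h'
  · unfold part
    rw [List.getD_eq_default _ _ (by omega)]
    exact Nat.zero_le _

@[simp] theorem psum_zero (s : Multiset ℕ) : psum s 0 = 0 := by simp [psum]

theorem psum_succ (s : Multiset ℕ) (j : ℕ) : psum s (j + 1) = psum s j + part s (j + 1) := by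
  unfold psum
  by_cases hj : j < (sortedDesc s).length
  · rw [part_eq_getElem hj, List.sum_take_succ _ _ hj]
  · rw [part_eq_zero (by rw [← length_sortedDesc]; omega),
      List.take_of_length_le (by omega), List.take_of_length_le (by omega), add_zero]

theorem psum_of_card_le {s : Multiset ℕ} {j : ℕ} (h : s.card ≤ j) : psum s j = s.sum := by
  unfold psum
  rw [List.take_of_length_le (by rwa [length_sortedDesc])]
  conv_rhs => rw [← coe_sortedDesc s]
  simp

theorem part_mem {s : Multiset ℕ} {j : ℕ} (h1 : 1 ≤ j) (h2 : j ≤ s.card) : part s j ∈ s := by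
  obtain ⟨i, rfl⟩ : ∃ i, j = i + 1 := ⟨j - 1, by omega⟩
  have hi : i < (sortedDesc s).length := by rw [length_sortedDesc]; omega
  have hmem : (sortedDesc s)[i] ∈ (sortedDesc s : Multiset ℕ) := by simp
  rwa [coe_sortedDesc, ← part_eq_getElem hi] at hmem

theorem psum_eq_sum_of_part_eq_zero {s : Multiset ℕ} (hs : PosParts s) {j : ℕ}
    (h : part s (j + 1) = 0) : psum s j = s.sum := by
  apply psum_of_card_le
  by_contra hj
  have := hs _ (part_mem (s := s) (j := j + 1) (by omega) (by omega))
  omega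

theorem minPart_eq_part (s : Multiset ℕ) : minPart s = part s s.card := by
  rcases Nat.eq_zero_or_pos s.card with h | h
  · rw [Multiset.card_eq_zero.mp h]
    simp [minPart, part, sortedDesc]
  · have hl : (s.sort (· ≤ ·)).length = s.card := Multiset.length_sort ..
    unfold minPart part sortedDesc
    rw [List.getD_eq_getElem _ _ (by omega), List.getD_eq_getElem _ _ (by simp; omega),
      List.getElem_reverse]
    congr 1
    omega

/-- A sorted list is recovered from its multiset. -/
theorem sortedDesc_coe {l : List ℕ} (h : l.Pairwise (· ≥ ·)) : sortedDesc (l : Multiset ℕ) = l :=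
  List.Perm.eq_of_pairwise' (sortedDesc_pairwise _) h
    (Multiset.coe_eq_coe.mp (coe_sortedDesc _))

theorem even_sum_of_even_count {s : Multiset ℕ} (h : ∀ x, Odd x → Even (s.count x)) :
    Even s.sum := by
  rw [Finset.sum_multiset_count]
  refine Finset.even_sum _ fun x _ => ?_
  rw [smul_eq_mul, Nat.even_mul]
  by_cases hx : Even x
  · exact Or.inr hx
  · exact Or.inl (h x (Nat.not_even_iff_odd.mp hx))

/-- In a C-partition, a partial sum can only be odd in the middle of a run of an odd part. -/
theorem part_eq_part_succ_of_odd_psum {s : Multiset ℕ} (hs : IsTypeC s) {j : ℕ}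
    (hj : Odd (psum s j)) : Odd (part s j) ∧ part s j = part s (j + 1) := by
  by_contra hcon
  refine Nat.not_even_iff_odd.mpr hj ?_
  unfold psum
  rw [← Multiset.sum_coe]
  refine even_sum_of_even_count fun x hx => ?_
  have hc : (sortedDesc s).count x = s.count x := by
    rw [← Multiset.coe_count, coe_sortedDesc]
  have hsplit : ((sortedDesc s).take j).count x + ((sortedDesc s).drop j).count x = s.count x := by
    rw [← hc, ← List.count_append, List.take_append_drop]
  have heven := hs.2.2 x hx
  rw [Multiset.coe_count]
  by_cases h1 : x ∈ (sortedDesc s).take j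
  · by_cases h2 : x ∈ (sortedDesc s).drop j
    · exfalso
      obtain ⟨i, hi, hi'⟩ := List.mem_take_iff_getElem.mp h1
      obtain ⟨k, hk, hk'⟩ := List.mem_drop_iff_getElem.mp h2
      rw [← part_eq_getElem] at hi' hk'
      have e1 := part_antitone s (show i + 1 ≤ j by omega)
      have e2 := part_antitone s (show j ≤ j + 1 by omega)
      have e3 := part_antitone s (show j + 1 ≤ j + k + 1 by omega)
      have e4 : part s j = x := by omega
      exact hcon ⟨e4 ▸ hx, by omega⟩
    · rw [List.count_eq_zero.mpr h2, add_zero] at hsplit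
      rwa [hsplit]
  · simp [List.count_eq_zero.mpr h1]

/-- A multiset with prescribed weakly decreasing sequence of parts. -/
theorem exists_psum_eq (c : ℕ → ℕ) (hc : Antitone c) (h0 : ∃ n, c n = 0) :
    ∃ (s : Multiset ℕ) (n : ℕ), c n = 0 ∧ PosParts s ∧ s = (Multiset.range n).map c ∧
      ∀ j, psum s j = ∑ i ∈ Finset.range j, c i := by
  classical
  let n := Nat.find h0
  have hn : c n = 0 := Nat.find_spec h0
  have hpos : ∀ i < n, 0 < c i := fun i hi => Nat.pos_of_ne_zero (Nat.find_min h0 hi)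
  refine ⟨_, n, hn, ?_, rfl, fun j => ?_⟩
  · intro x hx
    obtain ⟨i, hi, rfl⟩ := Multiset.mem_map.mp hx
    exact hpos i (Multiset.mem_range.mp hi)
  · have hl : ((List.range n).map c).Pairwise (· ≥ ·) := by
      rw [List.pairwise_map]
      exact List.pairwise_lt_range.imp fun h => hc h.le
    have hs : (Multiset.range n).map c = (((List.range n).map c : List ℕ) : Multiset ℕ) := rfl
    unfold psum
    rw [hs, sortedDesc_coe hl, ← List.map_take, List.take_range, ← List.sum_toFinset]
    · rw [List.toFinset_range]
      refine Finset.sum_subset (by simp) fun i _ hi => ?_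
      have : n ≤ i := by simp at *; omega
      exact Nat.eq_zero_of_le_zero (hn ▸ hc this)
    · exact List.nodup_range

theorem odd_count_iff (c : ℕ → ℕ)
    (hc : ∀ j, Odd (∑ i ∈ Finset.range (j + 1), c i) → c j = c (j + 1))
    {x : ℕ} (hx : Odd x) (j : ℕ) :
    Odd (((Multiset.range j).map c).count x) ↔
      Odd (∑ i ∈ Finset.range j, c i) ∧ c (j - 1) = x := by
  induction j with
  | zero => simp
  | succ j ih =>
    have hprev : Odd (∑ i ∈ Finset.range j, c i) → c (j - 1) = c j := by
      rcases j with _ | j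
      · simp
      · exact hc j
    rw [Multiset.range_succ, Multiset.map_cons, Multiset.count_cons, Finset.sum_range_succ,
      Nat.add_sub_cancel]
    by_cases h : c j = x
    · subst h
      rw [if_pos rfl, Nat.odd_add_one, ih, Nat.odd_add']
      simp only [and_true, hx, true_iff]
      rw [← Nat.not_odd_iff_even]
      tauto
    · rw [if_neg (Ne.symm h), add_zero, ih]
      constructor
      · rintro ⟨h1, h2⟩
        exact absurd ((hprev h1).symm.trans h2) h
      · rintro ⟨-, h2⟩
        exact absurd h2 h

/-- The amount by which the C-collapse lowers the `j`-th partial sum. -/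
def collapseDefect (s : Multiset ℕ) (j : ℕ) : ℕ :=
  if Odd (psum s j) ∧ ¬ (Odd (part s j) ∧ part s j = part s (j + 1)) then 1 else 0

theorem collapseDefect_of_even {s : Multiset ℕ} {j : ℕ} (h : Even (psum s j)) :
    collapseDefect s j = 0 :=
  if_neg fun h' => Nat.not_even_iff_odd.mpr h'.1 h

theorem collapseDefect_le_one (s : Multiset ℕ) (j : ℕ) : collapseDefect s j ≤ 1 := by
  unfold collapseDefect
  split_ifs <;> omega

/-- The parts of the C-collapse, indexed from `0`. -/
def collapsePart (s : Multiset ℕ) (k : ℕ) : ℕ :=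
  part s (k + 1) + collapseDefect s k - collapseDefect s (k + 1)

theorem collapseDefect_succ_le {s : Multiset ℕ} (hs : PosParts s) (he : Even s.sum) (k : ℕ) :
    collapseDefect s (k + 1) ≤ part s (k + 1) + collapseDefect s k := by
  rcases Nat.eq_zero_or_pos (part s (k + 1)) with h | h
  · rw [collapseDefect_of_even]
    · exact Nat.zero_le _
    · rw [psum_succ, h, psum_eq_sum_of_part_eq_zero hs h]
      exact he
  · have := collapseDefect_le_one s (k + 1)
    omega

theorem sum_collapsePart {s : Multiset ℕ} (hs : PosParts s) (he : Even s.sum) (j : ℕ) :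
    ∑ i ∈ Finset.range j, collapsePart s i + collapseDefect s j = psum s j := by
  induction j with
  | zero => simp [collapseDefect]
  | succ j ih =>
    rw [Finset.sum_range_succ, psum_succ, ← ih, collapsePart]
    have := collapseDefect_succ_le hs he j
    omega

theorem collapseDefect_eq_one {s : Multiset ℕ} {j : ℕ} (h : Odd (psum s j))
    (h' : Odd (part s j) → part s j ≠ part s (j + 1)) : collapseDefect s j = 1 :=
  if_pos ⟨h, fun h2 => h' h2.1 h2.2⟩

theorem collapsePart_antitone {s : Multiset ℕ} (hs : PosParts s) (he : Even s.sum) :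
    Antitone (collapsePart s) := by
  refine antitone_nat_of_succ_le fun k => ?_
  have h1 := collapseDefect_succ_le hs he k
  have h2 := collapseDefect_succ_le hs he (k + 1)
  have hA := part_antitone s (show k + 1 ≤ k + 2 by omega)
  have b1 := collapseDefect_le_one s (k + 1)
  suffices h : part s (k + 2) + 2 * collapseDefect s (k + 1) ≤
      part s (k + 1) + collapseDefect s k + collapseDefect s (k + 2) by
    unfold collapsePart
    simp only [add_assoc, Nat.reduceAdd] at *
    omega
  by_cases hd : Odd (psum s (k + 1)) ∧
      ¬ (Odd (part s (k + 1)) ∧ part s (k + 1) = part s (k + 1 + 1))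
  · obtain ⟨ho, hne⟩ := hd
    have hk : Even (part s (k + 1)) → collapseDefect s k = 1 := by
      intro hev
      apply collapseDefect_eq_one
      · rw [psum_succ] at ho
        exact (Nat.odd_add.mp ho).mpr hev
      · intro h h'
        exact Nat.not_even_iff_odd.mpr h (h' ▸ hev)
    have hk2 : Even (part s (k + 2)) → collapseDefect s (k + 2) = 1 := by
      intro hev
      apply collapseDefect_eq_one
      · rw [psum_succ]
        exact ho.add_even hev
      · intro h
        exact absurd hev (Nat.not_even_iff_odd.mpr h)
    simp only [add_assoc, Nat.reduceAdd] at *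
    by_cases e1 : Even (part s (k + 1)) <;> by_cases e2 : Even (part s (k + 2))
    · have := hk e1
      have := hk2 e2
      omega
    · have := hk e1
      rw [Nat.even_iff] at e1 e2
      omega
    · have := hk2 e2
      rw [Nat.even_iff] at e1 e2
      omega
    · have hne' : part s (k + 1) ≠ part s (k + 2) := fun h =>
        hne ⟨Nat.not_even_iff_odd.mp e1, h⟩
      rw [Nat.even_iff] at e1 e2
      omega
  · rw [show collapseDefect s (k + 1) = 0 from if_neg hd]
    omega

theorem odd_psum_of_odd_sub {s : Multiset ℕ} {j m : ℕ} (h : m + collapseDefect s j = psum s j)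
    (hm : Odd m) : collapseDefect s j = 0 ∧ Odd (psum s j) ∧
      Odd (part s j) ∧ part s j = part s (j + 1) := by
  by_cases hd : Odd (psum s j) ∧ ¬ (Odd (part s j) ∧ part s j = part s (j + 1))
  · have h1 : collapseDefect s j = 1 := if_pos hd
    have := hd.1
    rw [Nat.odd_iff] at *
    omega
  · have h1 : collapseDefect s j = 0 := if_neg hd
    rw [h1, add_zero] at h
    rw [h] at hm
    exact ⟨h1, hm, by tauto⟩

theorem collapsePart_eq_succ {s : Multiset ℕ} (hs : PosParts s) (he : Even s.sum) (j : ℕ)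
    (h : Odd (∑ i ∈ Finset.range (j + 1), collapsePart s i)) :
    collapsePart s j = collapsePart s (j + 1) := by
  obtain ⟨h0, hP, hA, hA'⟩ := odd_psum_of_odd_sub (sum_collapsePart hs he (j + 1)) h
  have h1 : collapseDefect s j = 0 := by
    apply collapseDefect_of_even
    rw [psum_succ] at hP
    exact (Nat.odd_add'.mp hP).mp hA
  have h2 : collapseDefect s (j + 1 + 1) = 0 := by
    apply collapseDefect_of_even
    rw [psum_succ]
    exact hP.add_odd (hA' ▸ hA)
  unfold collapsePart
  rw [h0, h1, h2, hA']

/-- The explicit C-collapse. -/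
theorem exists_typeC_psum {s : Multiset ℕ} (hs : PosParts s) (he : Even s.sum) :
    ∃ t, IsTypeC t ∧ t.sum = s.sum ∧ ∀ j, psum t j + collapseDefect s j = psum s j := by
  have hz : collapsePart s s.card = 0 := by
    have h1 : psum s s.card = s.sum := psum_of_card_le le_rfl
    unfold collapsePart
    rw [part_eq_zero (by omega), collapseDefect_of_even (h1 ▸ he)]
    omega
  obtain ⟨t, n, hn, htpos, ht, hpt⟩ :=
    exists_psum_eq (collapsePart s) (collapsePart_antitone hs he) ⟨_, hz⟩
  have hsum : ∀ j, psum t j + collapseDefect s j = psum s j := fun j => by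
    rw [hpt, sum_collapsePart hs he]
  have htot : t.sum = s.sum := by
    have h1 : psum t (max t.card s.card) = t.sum := psum_of_card_le (le_max_left _ _)
    have h2 : psum s (max t.card s.card) = s.sum := psum_of_card_le (le_max_right _ _)
    have h3 := hsum (max t.card s.card)
    rwa [collapseDefect_of_even (h2 ▸ he), h1, h2, add_zero] at h3
  refine ⟨t, ⟨htpos, htot ▸ he, fun x hx => ?_⟩, htot, hsum⟩
  rw [← Nat.not_odd_iff_even, ht, odd_count_iff _ (collapsePart_eq_succ hs he) hx]
  rintro ⟨h1, -⟩
  have hcard : t.card = n := by simp [ht]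
  rw [← hpt, psum_of_card_le hcard.le, htot] at h1
  exact Nat.not_even_iff_odd.mpr h1 he

/-- The partial sums of the C-collapse. -/
theorem IsCollapse.psum_add {a b : Multiset ℕ} (hpos : PosParts a) (heven : Even a.sum)
    (hb : IsCollapse IsTypeC a b) (j : ℕ) : psum b j + collapseDefect a j = psum a j := by
  obtain ⟨t, htC, htsum, ht⟩ := exists_typeC_psum hpos heven
  obtain ⟨hbC, -, hle, hmax⟩ := hb
  have h1 : psum t j ≤ psum b j :=
    hmax t htC htsum (fun i => by have := ht i; omega) j
  have h2 := hle j
  have h3 := ht j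
  have h4 := collapseDefect_le_one a j
  by_contra hne
  have h5 : psum b j = psum a j := by omega
  have hd : Odd (psum a j) ∧ ¬ (Odd (part a j) ∧ part a j = part a (j + 1)) := by
    by_contra hd
    have : collapseDefect a j = 0 := if_neg hd
    omega
  obtain ⟨ho, hcon⟩ := hd
  obtain ⟨hbo, hbe⟩ := part_eq_part_succ_of_odd_psum hbC (h5 ▸ ho)
  obtain ⟨i, rfl⟩ : ∃ i, j = i + 1 := ⟨j - 1, by
    rcases j with _ | j
    · simp at ho
    · omega⟩
  have e1 := hle i
  have e2 := hle (i + 1 + 1)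
  have e3 := part_antitone a (show i + 1 ≤ i + 1 + 1 by omega)
  rw [psum_succ b (i + 1), psum_succ a (i + 1)] at e2
  rw [psum_succ a i, psum_succ b i] at h5
  rw [psum_succ a i, psum_succ b i] at e2
  have e4 : part a (i + 1) = part b (i + 1) := by omega
  exact hcon ⟨e4 ▸ hbo, by omega⟩

theorem even_eCount_one_iff (s : Multiset ℕ) (j : ℕ) :
    Even (eCount s 1 j) ↔ Even (psum s j + j) := by
  induction j with
  | zero => simp [eCount]
  | succ j ih =>
    unfold eCount at *
    rw [← Finset.insert_Icc_right_eq_Icc_add_one (by omega : (1 : ℕ) ≤ j + 1),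
      Finset.filter_insert, psum_succ]
    split_ifs with h
    · rw [Finset.card_insert_of_notMem (by simp), Nat.even_add_one, ih]
      simp only [Nat.even_iff] at *
      omega
    · rw [ih]
      simp only [Nat.even_iff] at *
      omega

theorem eCount_one_add {s : Multiset ℕ} {i j : ℕ} (hi : OddIdx s i) (hij : i ≤ j) :
    eCount s 1 j = eCount s 1 i + eCount s i j := by
  have h1 := hi.1
  unfold eCount
  rw [← Finset.card_union_of_disjoint]
  · congr 1
    ext k
    simp only [Finset.mem_union, Finset.mem_filter, Finset.mem_Icc]
    constructor
    · rintro ⟨h, h'⟩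
      rcases le_total k i with hk | hk
      · exact Or.inl ⟨⟨h.1, hk⟩, h'⟩
      · exact Or.inr ⟨⟨hk, h.2⟩, h'⟩
    · rintro (⟨h, h'⟩ | ⟨h, h'⟩)
      · exact ⟨by omega, h'⟩
      · exact ⟨by omega, h'⟩
  · rw [Finset.disjoint_left]
    intro k hk hk'
    simp only [Finset.mem_filter, Finset.mem_Icc] at hk hk'
    have : k = i := by omega
    subst this
    exact Nat.not_even_iff_odd.mpr hi.2 hk.2

theorem isSpecialE_of_forall {s : Multiset ℕ} (h : ∀ j, OddIdx s j → Even (psum s j + j)) :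
    IsSpecialE s := by
  refine ⟨fun t ht _ => (even_eCount_one_iff s t).mpr (h t ht), fun i j hi hj hij _ => ?_⟩
  have h1 := (even_eCount_one_iff s i).mpr (h i hi)
  have h2 := (even_eCount_one_iff s j).mpr (h j hj)
  rw [eCount_one_add hi hij.le] at h2
  exact (Nat.even_add.mp h2).mp h1

theorem IsQuasiSpecialE.even_eCount {s : Multiset ℕ} (h : IsQuasiSpecialE s) {j : ℕ}
    (hj : OddIdx s j) (hlast : ∃ k, OddIdx s k ∧ j < k) : Even (eCount s 1 j) := by
  classical
  induction j using Nat.strong_induction_on with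
  | _ j ih =>
    by_cases hex : ∃ i, OddIdx s i ∧ i < j
    · obtain ⟨i₀, hi₀, hi₀j⟩ := hex
      let i := Nat.findGreatest (fun i => OddIdx s i ∧ i < j) j
      obtain ⟨hi, hij⟩ : OddIdx s i ∧ i < j :=
        Nat.findGreatest_spec (P := fun i => OddIdx s i ∧ i < j) hi₀j.le ⟨hi₀, hi₀j⟩
      rw [eCount_one_add hi hij.le]
      refine (ih i hij hi ⟨j, hj, hij⟩).add (h.2.1 i j hi hj hij (fun k hk => ?_) hlast)
      by_contra! hcon
      exact absurd (Nat.le_findGreatest (P := fun i => OddIdx s i ∧ i < j) hcon.2.le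
        ⟨hk, hcon.2⟩) (not_le.mpr hcon.1)
    · push Not at hex
      exact h.1 j hj hex

theorem part_ne_of_count_minPart {s : Multiset ℕ} (h : s.count (minPart s) = 1) {j : ℕ}
    (h1 : 1 ≤ j) (hj : j + 1 = s.card) : part s j ≠ part s (j + 1) := by
  intro heq
  obtain ⟨i, rfl⟩ : ∃ i, j = i + 1 := ⟨j - 1, by omega⟩
  rw [minPart_eq_part, ← hj] at h
  have hl := length_sortedDesc s
  have hi : i < (sortedDesc s).length := by omega
  have hi' : i + 1 < (sortedDesc s).length := by omega
  rw [part_eq_getElem hi, part_eq_getElem hi'] at heq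
  rw [part_eq_getElem hi'] at h
  have hc : (sortedDesc s).count (sortedDesc s)[i + 1] = 1 := by
    rwa [← Multiset.coe_count, coe_sortedDesc]
  have hdup : List.Duplicate (sortedDesc s)[i + 1] (sortedDesc s) :=
    List.duplicate_iff_exists_distinct_get.mpr
      ⟨⟨i, hi⟩, ⟨i + 1, hi'⟩, by simp, by simpa using heq.symm, by simp⟩
  have := List.duplicate_iff_two_le_count.mp hdup
  omega

/-- If a partition `α` of an even number is quasi-special, then its
C-collapse `α_C` is special (in the e-count sense). -/
theorem statement2 (a : Multiset ℕ) (hpos : PosParts a) (heven : Even a.sum)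
    (hspec : IsQuasiSpecialE a)
    (b : Multiset ℕ) (hb : IsCollapse IsTypeC a b) :
    IsSpecialE b := by
  apply isSpecialE_of_forall
  rintro j ⟨hj1, hbo⟩
  obtain ⟨i, rfl⟩ : ∃ i, j = i + 1 := ⟨j - 1, by omega⟩
  have hi := hb.psum_add hpos heven i
  have hi' := hb.psum_add hpos heven (i + 1)
  have hsa := psum_succ a i
  have hsb := psum_succ b i
  have ha : Odd (part a (i + 1)) := by
    by_contra hev
    rw [Nat.not_odd_iff_even] at hev
    have hdef : collapseDefect a (i + 1) = collapseDefect a i := by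
      rcases Nat.even_or_odd (psum a i) with h | h
      · rw [collapseDefect_of_even h, collapseDefect_of_even]
        rw [hsa]
        exact h.add hev
      · rw [collapseDefect_eq_one h, collapseDefect_eq_one]
        · rw [hsa]
          exact h.add_even hev
        · exact fun h' => absurd hev (Nat.not_even_iff_odd.mpr h')
        · exact fun h' h2 => absurd (h2 ▸ hev) (Nat.not_even_iff_odd.mpr h')
    have : part b (i + 1) = part a (i + 1) := by omega
    exact Nat.not_even_iff_odd.mpr hbo (this ▸ hev)
  have hzero : collapseDefect a i = 0 ∧ collapseDefect a (i + 1) = 0 := by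
    have b1 := collapseDefect_le_one a i
    have b2 := collapseDefect_le_one a (i + 1)
    rcases Nat.even_or_odd (psum a i) with h | h
    · have := collapseDefect_of_even h
      rw [Nat.odd_iff] at *
      omega
    · have : collapseDefect a (i + 1) = 0 := by
        apply collapseDefect_of_even
        rw [hsa]
        exact h.add_odd ha
      rw [Nat.odd_iff] at *
      omega
  have hcard : i + 1 ≤ a.card := by
    by_contra hlt
    rw [part_eq_zero (by omega)] at ha
    simp at ha
  have hpsum : psum b (i + 1) = psum a (i + 1) := by omega
  rcases hcard.eq_or_lt with hlast | hlt
  · exfalso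
    have htot : Even (psum a (i + 1)) := by rwa [psum_of_card_le hlast.ge]
    have hodd : Odd (psum a i) := by
      rw [hsa] at htot
      rw [← Nat.not_even_iff_odd, Nat.even_add.mp htot]
      exact Nat.not_even_iff_odd.mpr ha
    have hi1 : 1 ≤ i := by
      rcases i with _ | i
      · simp at hodd
      · omega
    have := collapseDefect_eq_one hodd
      fun _ => part_ne_of_count_minPart hspec.2.2.2 hi1 hlast
    omega
  · rw [hpsum, ← even_eCount_one_iff]
    exact hspec.even_eCount ⟨hj1, ha⟩
      ⟨a.card, ⟨by omega, minPart_eq_part a ▸ hspec.2.2.1⟩, hlt⟩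

end WFPaper
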